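/- arXiv:1904.00885 — 8 statements merged into one kernel-verified Lean document; each statement's English description precedes it below -/
import Mathlib

section
/- Let d ≥ 1 and let μ be a finite non-atomic Borel measure on ℝ^d with finite first moment. Then for every x ∈ ℝ^d the function Φ_μ is differentiable at x, with gradient equal to g_μ(x) = ∫ (x − z)/‖x − z‖ dμ(z). (In Lean: HasGradientAt Φ_μ (g_μ x) x for every x.) -/
open MeasureTheory

/-- The function `Φ_μ(x) = ∫ ‖x − z‖ dμ(z)` associated to a finite non-atomic Borel
measure with finite first moment is differentiable everywhere, with gradient
`g_μ(x) = ∫ (x − z)/‖x − z‖ dμ(z)`. -/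
theorem stmt_0 (d : ℕ) (hd : 1 ≤ d)
    (μ : Measure (EuclideanSpace ℝ (Fin d))) [IsFiniteMeasure μ]
    (hatom : ∀ x : EuclideanSpace ℝ (Fin d), μ {x} = 0)
    (hmom : Integrable (fun z : EuclideanSpace ℝ (Fin d) => ‖z‖) μ) :
    ∀ x : EuclideanSpace ℝ (Fin d),
      HasGradientAt (fun y : EuclideanSpace ℝ (Fin d) => ∫ z, ‖y - z‖ ∂μ)
        (∫ z, ‖x - z‖⁻¹ • (x - z) ∂μ) x := by
  intro x
  rw [hasGradientAt_iff_hasFDerivAt]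
  have hmeas : Measurable (fun z : EuclideanSpace ℝ (Fin d) => ‖x - z‖⁻¹ • (x - z)) := by
    fun_prop
  have hint : Integrable (fun z : EuclideanSpace ℝ (Fin d) => x - z) μ := by
    refine (integrable_const x).sub ?_
    exact (integrable_norm_iff (by fun_prop)).1 hmom
  have key := hasFDerivAt_integral_of_dominated_loc_of_lip' (𝕜 := ℝ) (μ := μ)
    (F := fun (y z : EuclideanSpace ℝ (Fin d)) => ‖y - z‖) (x₀ := x) (s := Set.univ)
    (bound := fun _ => (1 : ℝ))
    (F' := fun z => InnerProductSpace.toDual ℝ (EuclideanSpace ℝ (Fin d))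
      (‖x - z‖⁻¹ • (x - z)))
    Filter.univ_mem (fun y _ => by fun_prop) hint.norm
    ((InnerProductSpace.toDual ℝ (EuclideanSpace ℝ (Fin d))).continuous.comp_aestronglyMeasurable
      hmeas.aestronglyMeasurable)
    (Filter.Eventually.of_forall fun z y _ => by
      have := abs_norm_sub_norm_le (y - z) (x - z)
      simpa using this)
    (integrable_const _)
    (by
      have h0 : ∀ᵐ z ∂μ, z ≠ x := by
        rw [ae_iff]
        simpa using hatom x
      filter_upwards [h0] with z hz
      have hne : x - z ≠ 0 := sub_ne_zero.2 (Ne.symm hz)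
      have hn : ‖x - z‖ ≠ 0 := norm_ne_zero_iff.2 hne
      have h1 := ((hasFDerivAt_id (𝕜 := ℝ) x).sub_const z).norm_sq
      have h2 := h1.sqrt (by simpa using hne)
      have hf : (fun y : EuclideanSpace ℝ (Fin d) => √(‖id y - z‖ ^ 2))
          = fun y => ‖y - z‖ := by
        funext y
        simp
      rw [hf] at h2
      refine h2.congr_fderiv ?_
      ext v
      simp [inner_smul_left]
      field_simp)
  have h := key.2
  have e := (InnerProductSpace.toDual ℝ (EuclideanSpace ℝ (Fin d))).toContinuousLinearEquiv.integral_comp_comm (μ := μ)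
    (fun z => ‖x - z‖⁻¹ • (x - z))
  refine h.congr_fderiv ?_
  exact e
end

section
/- Let d ≥ 1 and let μ be a finite Borel measure on ℝ^d with finite first moment whose support is not contained in a line. Then the function Φ_μ(x) = ∫ ‖x − z‖ dμ(z) is strictly convex on ℝ^d (StrictConvexOn ℝ Set.univ Φ_μ). -/
open MeasureTheory

/-- If the support of a finite Borel measure `μ` with finite first moment is not contained
in a line, then `Φ_μ(x) = ∫ ‖x − z‖ dμ(z)` is strictly convex on `ℝ^d`. -/
theorem stmt_1 (d : ℕ) (hd : 1 ≤ d)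
    (μ : Measure (EuclideanSpace ℝ (Fin d))) [IsFiniteMeasure μ]
    (hmom : Integrable (fun z : EuclideanSpace ℝ (Fin d) => ‖z‖) μ)
    (hline : ∀ a v : EuclideanSpace ℝ (Fin d),
      μ {x | ∃ t : ℝ, x = a + t • v} < μ Set.univ) :
    StrictConvexOn ℝ Set.univ
      (fun x : EuclideanSpace ℝ (Fin d) => ∫ z, ‖x - z‖ ∂μ) := by
  have hid : Integrable (fun z : EuclideanSpace ℝ (Fin d) => z) μ :=
    (integrable_norm_iff (by fun_prop)).1 hmom
  have hint : ∀ x : EuclideanSpace ℝ (Fin d), Integrable (fun z => ‖x - z‖) μ :=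
    fun x => ((integrable_const x).sub hid).norm
  refine ⟨convex_univ, ?_⟩
  intro x _ y _ hxy a b ha hb hab
  have hsplit : ∀ z, a • x + b • y - z = a • (x - z) + b • (y - z) := by
    intro z
    have hz : z = a • z + b • z := by rw [← add_smul, hab, one_smul]
    calc a • x + b • y - z = a • x + b • y - (a • z + b • z) := by rw [← hz]
      _ = _ := by module
  have hn : ∀ z, a * ‖x - z‖ + b * ‖y - z‖ = ‖a • (x - z)‖ + ‖b • (y - z)‖ := by
    intro z
    rw [norm_smul, norm_smul, Real.norm_of_nonneg ha.le, Real.norm_of_nonneg hb.le]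
  have hI : Integrable (fun z => a * ‖x - z‖ + b * ‖y - z‖) μ :=
    ((hint x).const_mul a).add ((hint y).const_mul b)
  have hle : ∀ z, ‖a • x + b • y - z‖ ≤ a * ‖x - z‖ + b * ‖y - z‖ := by
    intro z
    rw [hn, hsplit]
    exact norm_add_le _ _
  have heq : ∫ z, (a * ‖x - z‖ + b * ‖y - z‖) ∂μ
      = a • (∫ z, ‖x - z‖ ∂μ) + b • (∫ z, ‖y - z‖ ∂μ) := by
    rw [integral_add ((hint x).const_mul a) ((hint y).const_mul b),
      integral_const_mul, integral_const_mul, smul_eq_mul, smul_eq_mul]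
  change ∫ z, ‖a • x + b • y - z‖ ∂μ < a • (∫ z, ‖x - z‖ ∂μ) + b • (∫ z, ‖y - z‖ ∂μ)
  rw [← heq]
  refine lt_of_le_of_ne (integral_mono (hint _) hI hle) fun h => ?_
  have hae := (integral_eq_iff_of_ae_le (hint _) hI (Filter.Eventually.of_forall hle)).1 h
  refine absurd (hline x (y - x)) (not_lt.2 (measure_mono_ae ?_))
  filter_upwards [hae] with z hz _
  change ∃ t : ℝ, z = x + t • (y - x)
  have hz' : ‖a • x + b • y - z‖ = a * ‖x - z‖ + b * ‖y - z‖ := hz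
  rw [hn, hsplit] at hz'
  rcases sameRay_iff_norm_add.2 hz' with h0 | h0 | ⟨r, s, hr, hs, h0⟩
  · refine ⟨0, ?_⟩
    have := (smul_eq_zero.1 h0).resolve_left ha.ne'
    rw [zero_smul, add_zero, sub_eq_zero.1 this]
  · refine ⟨1, ?_⟩
    have := (smul_eq_zero.1 h0).resolve_left hb.ne'
    rw [one_smul, sub_eq_zero.1 this, add_sub_cancel]
  · rw [smul_smul, smul_smul] at h0
    have hne : r * a - s * b ≠ 0 := by
      intro he
      rw [sub_eq_zero.1 he] at h0
      have := smul_right_injective _ (mul_pos hs hb).ne' h0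
      exact hxy (sub_left_injective this)
    refine ⟨-(s * b) / (r * a - s * b), ?_⟩
    apply smul_right_injective _ hne
    change (r * a - s * b) • z = (r * a - s * b) • (x + _)
    rw [smul_add, smul_smul, mul_div_cancel₀ _ hne]
    rw [← sub_eq_zero] at h0 ⊢
    rw [← neg_eq_zero, ← h0]
    module
end

section
/- Let d ≥ 1 and let μ be a nonzero finite Borel measure on ℝ^d with finite first moment whose support is not contained in a line. Then there exists a unique point x₀ ∈ ℝ^d at which Φ_μ attains its global minimum, i.e. ∃! x₀, ∀ x ∈ ℝ^d, Φ_μ(x₀) ≤ Φ_μ(x). This unique minimizer is the centre of mass of μ. -/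
open MeasureTheory

/-- A nonzero finite Borel measure `μ` with finite first moment whose support is not
contained in a line has a unique centre of mass, i.e. `Φ_μ` has a unique global minimizer. -/
theorem stmt_3 (d : ℕ) (hd : 1 ≤ d)
    (μ : Measure (EuclideanSpace ℝ (Fin d))) [IsFiniteMeasure μ] (hμ : μ ≠ 0)
    (hmom : Integrable (fun z : EuclideanSpace ℝ (Fin d) => ‖z‖) μ)
    (hline : ∀ a v : EuclideanSpace ℝ (Fin d),
      μ {x | ∃ t : ℝ, x = a + t • v} < μ Set.univ) :
    ∃! x₀ : EuclideanSpace ℝ (Fin d),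
      ∀ x : EuclideanSpace ℝ (Fin d), (∫ z, ‖x₀ - z‖ ∂μ) ≤ ∫ z, ‖x - z‖ ∂μ := by
  have hint : ∀ x : EuclideanSpace ℝ (Fin d), Integrable (fun z => ‖x - z‖) μ := by
    intro x
    refine Integrable.mono' ((integrable_const ‖x‖).add hmom)
      (by fun_prop) (Filter.Eventually.of_forall fun z => ?_)
    simpa using norm_sub_le x z
  have hM : 0 < μ.real Set.univ := by
    have : NeZero μ := ⟨hμ⟩
    exact measureReal_univ_pos
  have hcont : Continuous (fun x : EuclideanSpace ℝ (Fin d) => ∫ z, ‖x - z‖ ∂μ) := by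
    refine (LipschitzWith.of_le_add_mul (μ.real Set.univ).toNNReal fun x y => ?_).continuous
    rw [Real.coe_toNNReal _ hM.le]
    have h1 : ∫ z, ‖x - z‖ ∂μ ≤ ∫ z, (‖y - z‖ + dist x y) ∂μ := by
      refine integral_mono (hint x) ((hint y).add (integrable_const _)) fun z => ?_
      have := norm_add_le (x - y) (y - z)
      rw [sub_add_sub_cancel] at this
      simp only [dist_eq_norm]
      linarith
    rw [integral_add (hint y) (integrable_const _), integral_const, smul_eq_mul] at h1
    exact h1
  have hcoer : Filter.Tendsto (fun x : EuclideanSpace ℝ (Fin d) => ∫ z, ‖x - z‖ ∂μ)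
      (Filter.cocompact _) Filter.atTop := by
    have h0 : Filter.Tendsto (fun x : EuclideanSpace ℝ (Fin d) =>
        μ.real Set.univ * ‖x‖ + -∫ z, ‖z‖ ∂μ) (Filter.cocompact _) Filter.atTop :=
      Filter.tendsto_atTop_add_const_right _ _
        ((tendsto_norm_cocompact_atTop).const_mul_atTop hM)
    refine Filter.tendsto_atTop_mono (fun x => ?_) h0
    have h1 : ∫ z, (‖x‖ - ‖z‖) ∂μ ≤ ∫ z, ‖x - z‖ ∂μ :=
      integral_mono ((integrable_const _).sub hmom) (hint x) fun z => norm_sub_norm_le x z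
    rw [integral_sub (integrable_const _) hmom, integral_const, smul_eq_mul] at h1
    linarith
  obtain ⟨x, hx⟩ := hcont.exists_forall_le hcoer
  refine ⟨x, hx, fun y hy => ?_⟩
  by_contra hne
  have hnorm : ∀ z : EuclideanSpace ℝ (Fin d),
      2 * ‖(1 / 2 : ℝ) • (x + y) - z‖ = ‖(x - z) + (y - z)‖ := by
    intro z
    have : (x - z) + (y - z) = (2 : ℝ) • ((1 / 2 : ℝ) • (x + y) - z) := by
      module
    rw [this, norm_smul]
    norm_num
  have hI2 := (hint ((1 / 2 : ℝ) • (x + y))).const_mul 2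
  have hI1 := (hint x).add (hint y)
  have hg : Integrable (fun z => (‖x - z‖ + ‖y - z‖) - 2 * ‖(1 / 2 : ℝ) • (x + y) - z‖) μ :=
    hI1.sub hI2
  have hg0 : ∀ z, 0 ≤ (‖x - z‖ + ‖y - z‖) - 2 * ‖(1 / 2 : ℝ) • (x + y) - z‖ := by
    intro z
    rw [hnorm]
    linarith [norm_add_le (x - z) (y - z)]
  have hz : ∫ z, ((‖x - z‖ + ‖y - z‖) - 2 * ‖(1 / 2 : ℝ) • (x + y) - z‖) ∂μ = 0 := by
    refine le_antisymm ?_ (integral_nonneg hg0)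
    have e1 := integral_sub hI1 hI2
    have e2 := integral_add (hint x) (hint y)
    simp only [Pi.add_apply] at e1
    rw [e1, e2, integral_const_mul]
    have := hx ((1 / 2 : ℝ) • (x + y))
    have := hy ((1 / 2 : ℝ) • (x + y))
    linarith
  have hae := (integral_eq_zero_iff_of_nonneg hg0 hg).1 hz
  refine (hline x (y - x)).ne (measure_congr ?_)
  rw [Filter.eventuallyEq_univ]
  filter_upwards [hae] with z hz
  simp only [Pi.zero_apply] at hz
  rw [hnorm] at hz
  have hs : SameRay ℝ (x - z) (y - z) := sameRay_iff_norm_add.2 (by linarith)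
  rcases hs with h | h | ⟨r, s, hr, hs, h⟩
  · exact ⟨0, by rw [zero_smul, add_zero]; exact (sub_eq_zero.1 h).symm⟩
  · exact ⟨1, by rw [one_smul, add_sub_cancel]; exact (sub_eq_zero.1 h).symm⟩
  · have hrs : s - r ≠ 0 := by
      intro h0
      have : s = r := by linarith
      subst this
      have := smul_right_injective _ hr.ne' h
      exact hne (sub_left_inj.1 this).symm
    refine ⟨s / (s - r), ?_⟩
    apply smul_right_injective _ hrs
    simp only [smul_add, smul_smul, mul_div_cancel₀ _ hrs]
    linear_combination (norm := module) (1 : ℝ) • h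
end

section
/- Let d ≥ 1 and let μ be a nonzero finite non-atomic Borel measure on ℝ^d with finite first moment whose support is not contained in a line. Then a point x₀ ∈ ℝ^d is the centre of mass of μ (i.e. a global minimizer of Φ_μ) if and only if g_μ(x₀) = ∫ (x₀ − z)/‖x₀ − z‖ dμ(z) = 0. -/
open MeasureTheory

theorem aux_sub {E : Type*} [NormedAddCommGroup E] [InnerProductSpace ℝ E] (a b : E) :
    ‖a‖ + inner ℝ (b - a) (‖a‖⁻¹ • a) ≤ ‖b‖ := by
  by_cases ha : a = 0
  · simp [ha]
  have h0 : 0 < ‖a‖ := norm_pos_iff.mpr ha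
  rw [inner_smul_right, inner_sub_left, real_inner_self_eq_norm_sq]
  have h1 := real_inner_le_norm b a
  have h2 : ‖a‖ + ‖a‖⁻¹ * (inner ℝ b a - ‖a‖ ^ 2) = ‖a‖⁻¹ * inner ℝ b a := by
    field_simp
    ring
  rw [h2, inv_mul_le_iff₀ h0]
  linarith

theorem aux_bound {E : Type*} [NormedAddCommGroup E] [NormedSpace ℝ E] (a : E) :
    ‖‖a‖⁻¹ • a‖ ≤ 1 := by
  rw [norm_smul, norm_inv, norm_norm]
  exact inv_mul_le_one

section
variable {d : ℕ} (μ : Measure (EuclideanSpace ℝ (Fin d))) [IsFiniteMeasure μ]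

theorem aux_meas (x : EuclideanSpace ℝ (Fin d)) :
    AEStronglyMeasurable (fun z => ‖x - z‖⁻¹ • (x - z)) μ := by
  apply Measurable.aestronglyMeasurable
  fun_prop

theorem aux_int (x : EuclideanSpace ℝ (Fin d)) :
    Integrable (fun z => ‖x - z‖⁻¹ • (x - z)) μ :=
  Integrable.of_bound (aux_meas μ x) 1 (Filter.Eventually.of_forall fun _ => aux_bound _)

theorem aux_ineq (hmom : Integrable (fun z : EuclideanSpace ℝ (Fin d) => ‖z‖) μ)
    (x y : EuclideanSpace ℝ (Fin d)) :
    (∫ z, ‖x - z‖ ∂μ) + inner ℝ (y - x) (∫ z, ‖x - z‖⁻¹ • (x - z) ∂μ) ≤ ∫ z, ‖y - z‖ ∂μ := by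
  have hz : Integrable (fun z : EuclideanSpace ℝ (Fin d) => z) μ :=
    (integrable_norm_iff (by fun_prop)).mp hmom
  have hn : ∀ w : EuclideanSpace ℝ (Fin d), Integrable (fun z => ‖w - z‖) μ := fun w =>
    ((integrable_const w).sub hz).norm
  have hi := (aux_int μ x).const_inner (𝕜 := ℝ) (y - x)
  rw [← integral_inner (aux_int μ x), ← integral_add (hn x) hi]
  refine integral_mono ((hn x).add hi) (hn y) fun z => ?_
  have := aux_sub (x - z) (y - z)
  simpa using this

theorem aux_cont (hatom : ∀ x : EuclideanSpace ℝ (Fin d), μ {x} = 0)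
    (x : EuclideanSpace ℝ (Fin d)) :
    ContinuousAt (fun y => ∫ z, ‖y - z‖⁻¹ • (y - z) ∂μ) x := by
  refine continuousAt_of_dominated (bound := fun _ => 1)
    (Filter.Eventually.of_forall fun y => aux_meas μ y)
    (Filter.Eventually.of_forall fun y => Filter.Eventually.of_forall fun z => aux_bound _)
    (integrable_const _) ?_
  have : ∀ᵐ z ∂μ, z ≠ x := by
    rw [ae_iff]
    simpa using hatom x
  filter_upwards [this] with z hz
  have h : ‖x - z‖ ≠ 0 := norm_ne_zero_iff.mpr (sub_ne_zero.mpr (Ne.symm hz))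
  have h2 : ContinuousAt (fun y => y - z) x := by fun_prop
  exact (h2.norm.inv₀ h).smul h2

end

/-- Gradient characterization of the centre of mass: a point `x₀` is a global minimizer of
`Φ_μ` if and only if `g_μ(x₀) = ∫ (x₀ − z)/‖x₀ − z‖ dμ(z) = 0`. -/
theorem stmt_4 (d : ℕ) (hd : 1 ≤ d)
    (μ : Measure (EuclideanSpace ℝ (Fin d))) [IsFiniteMeasure μ] (hμ : μ ≠ 0)
    (hatom : ∀ x : EuclideanSpace ℝ (Fin d), μ {x} = 0)
    (hmom : Integrable (fun z : EuclideanSpace ℝ (Fin d) => ‖z‖) μ)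
    (hline : ∀ a v : EuclideanSpace ℝ (Fin d),
      μ {x | ∃ t : ℝ, x = a + t • v} < μ Set.univ) :
    ∀ x₀ : EuclideanSpace ℝ (Fin d),
      (∀ x : EuclideanSpace ℝ (Fin d), (∫ z, ‖x₀ - z‖ ∂μ) ≤ ∫ z, ‖x - z‖ ∂μ) ↔
        (∫ z, ‖x₀ - z‖⁻¹ • (x₀ - z) ∂μ) = 0 := by
  intro x₀
  constructor
  · intro hmin
    set G : EuclideanSpace ℝ (Fin d) → EuclideanSpace ℝ (Fin d) :=
      fun y => ∫ z, ‖y - z‖⁻¹ • (y - z) ∂μ with hG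
    change G x₀ = 0
    have hle : ∀ t : ℝ, 0 < t → inner ℝ (G x₀) (G (x₀ - t • G x₀)) ≤ 0 := by
      intro t ht
      have h1 := aux_ineq μ hmom (x₀ - t • G x₀) x₀
      have h2 := hmin (x₀ - t • G x₀)
      rw [sub_sub_cancel, real_inner_smul_left] at h1
      have h3 : t * inner ℝ (G x₀) (G (x₀ - t • G x₀)) ≤ 0 := by
        simp only [hG] at h1 h2 ⊢
        linarith
      by_contra hc
      push Not at hc
      have := mul_pos ht hc
      linarith
    have hlim : Filter.Tendsto (fun t : ℝ => inner ℝ (G x₀) (G (x₀ - t • G x₀)))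
        (nhdsWithin 0 (Set.Ioi 0)) (nhds (inner ℝ (G x₀) (G x₀))) := by
      have hc : ContinuousAt G x₀ := aux_cont μ hatom x₀
      have ht : Filter.Tendsto (fun t : ℝ => x₀ - t • G x₀) (nhdsWithin 0 (Set.Ioi 0))
          (nhds x₀) := by
        have : Continuous (fun t : ℝ => x₀ - t • G x₀) := by fun_prop
        have h := this.tendsto 0
        simp only [zero_smul, sub_zero] at h
        exact h.mono_left nhdsWithin_le_nhds
      exact tendsto_const_nhds.inner (hc.tendsto.comp ht)
    have := le_of_tendsto hlim (Filter.eventually_of_mem self_mem_nhdsWithin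
      fun t ht => hle t ht)
    rw [real_inner_self_eq_norm_sq] at this
    exact norm_eq_zero.mp (pow_eq_zero_iff two_ne_zero |>.mp (le_antisymm this (sq_nonneg _)))
  · intro h x
    have := aux_ineq μ hmom x₀ x
    rw [h, inner_zero_right, add_zero] at this
    exact this
end

section
/- Let d ≥ 1 and let μ be a finite non-atomic Borel measure on ℝ^d with finite first moment such that μ(B(0,1)) > (3/4)·μ(ℝ^d). Then for every x₀ ∈ ℝ^d with ‖x₀‖ ≥ 2 one has ⟨x₀, g_μ(x₀)⟩ ≥ ‖x₀‖ · ((1/3)·μ(B(0,1)) − μ(ℝ^d \ B(0,1))) > 0; in particular g_μ(x₀) ≠ 0, so no point of norm ≥ 2 can satisfy the centre-of-mass equation g_μ(x₀) = 0. (Measure values are compared as real numbers via their finite total mass.) -/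
open MeasureTheory
open scoped RealInnerProductSpace

/-- The key inequality (eq:angle) in the proof of the gravity principle: if more than
three quarters of the mass of `μ` lies in `B(0,1)`, then for every `x₀` with `‖x₀‖ ≥ 2` the
inner product `⟨x₀, g_μ(x₀)⟩` is at least `‖x₀‖·((1/3)μ(B(0,1)) − μ(ℝ^d \ B(0,1))) > 0`;
in particular `g_μ(x₀) ≠ 0`. -/
theorem stmt_5 (d : ℕ) (hd : 1 ≤ d)
    (μ : Measure (EuclideanSpace ℝ (Fin d))) [IsFiniteMeasure μ]
    (hatom : ∀ x : EuclideanSpace ℝ (Fin d), μ {x} = 0)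
    (hmom : Integrable (fun z : EuclideanSpace ℝ (Fin d) => ‖z‖) μ)
    (hball : (3 / 4 : ℝ) * (μ Set.univ).toReal <
      (μ (Metric.ball (0 : EuclideanSpace ℝ (Fin d)) 1)).toReal)
    (x₀ : EuclideanSpace ℝ (Fin d)) (hx₀ : 2 ≤ ‖x₀‖) :
    ‖x₀‖ * ((1 / 3 : ℝ) * (μ (Metric.ball (0 : EuclideanSpace ℝ (Fin d)) 1)).toReal
        - (μ (Set.univ \ Metric.ball (0 : EuclideanSpace ℝ (Fin d)) 1)).toReal)
      ≤ ⟪x₀, ∫ z, ‖x₀ - z‖⁻¹ • (x₀ - z) ∂μ⟫ ∧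
    0 < ‖x₀‖ * ((1 / 3 : ℝ) * (μ (Metric.ball (0 : EuclideanSpace ℝ (Fin d)) 1)).toReal
        - (μ (Set.univ \ Metric.ball (0 : EuclideanSpace ℝ (Fin d)) 1)).toReal) ∧
    (∫ z, ‖x₀ - z‖⁻¹ • (x₀ - z) ∂μ) ≠ 0 := by
  set B : Set (EuclideanSpace ℝ (Fin d)) := Metric.ball 0 1 with hB
  have hBm : MeasurableSet B := Metric.isOpen_ball.measurableSet
  set R := ‖x₀‖ with hR
  have hnorm : ∀ z : EuclideanSpace ℝ (Fin d), ‖‖x₀ - z‖⁻¹ • (x₀ - z)‖ ≤ 1 := by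
    intro z
    rw [norm_smul, norm_inv, norm_norm]
    exact inv_mul_le_one
  have hint : Integrable (fun z => ‖x₀ - z‖⁻¹ • (x₀ - z)) μ := by
    refine Integrable.of_bound (C := 1) ?_ (Filter.Eventually.of_forall hnorm)
    exact Measurable.aestronglyMeasurable (by fun_prop)
  have hsum : (μ B).toReal + (μ (Set.univ \ B)).toReal = (μ Set.univ).toReal := by
    rw [← Set.compl_eq_univ_diff]
    exact measureReal_add_measureReal_compl hBm
  have hpos : 0 < R * ((1 / 3 : ℝ) * (μ B).toReal - (μ (Set.univ \ B)).toReal) := by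
    apply mul_pos <;> linarith
  have hmain : R * ((1 / 3 : ℝ) * (μ B).toReal - (μ (Set.univ \ B)).toReal)
      ≤ ⟪x₀, ∫ z, ‖x₀ - z‖⁻¹ • (x₀ - z) ∂μ⟫ := by
    rw [← integral_inner hint]
    have hi : Integrable (fun z => ⟪x₀, ‖x₀ - z‖⁻¹ • (x₀ - z)⟫) μ := hint.const_inner x₀
    rw [← integral_add_compl hBm hi]
    have h1 : (R / 3) * μ.real B ≤ ∫ z in B, ⟪x₀, ‖x₀ - z‖⁻¹ • (x₀ - z)⟫ ∂μ := by
      refine setIntegral_ge_of_const_le_real hBm (measure_ne_top _ _) ?_ hi.integrableOn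
      intro z hz
      have hz1 : ‖z‖ < 1 := by simpa [hB] using hz
      have ha : ‖x₀ - z‖ ≤ R + 1 := (norm_sub_le _ _).trans (by linarith)
      have hb : 0 < ‖x₀ - z‖ := by
        have := norm_sub_norm_le x₀ z
        linarith
      have hc : ⟪x₀, z⟫ ≤ R * 1 :=
        (real_inner_le_norm _ _).trans (mul_le_mul_of_nonneg_left hz1.le (norm_nonneg _))
      rw [inner_smul_right, inner_sub_right, real_inner_self_eq_norm_sq, ← hR,
        inv_mul_eq_div, le_div_iff₀ hb]
      nlinarith
    have h2 : (-R) * μ.real Bᶜ ≤ ∫ z in Bᶜ, ⟪x₀, ‖x₀ - z‖⁻¹ • (x₀ - z)⟫ ∂μ := by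
      refine setIntegral_ge_of_const_le_real hBm.compl (measure_ne_top _ _) ?_ hi.integrableOn
      intro z _
      have h := (abs_le.1 (abs_real_inner_le_norm x₀ (‖x₀ - z‖⁻¹ • (x₀ - z)))).1
      have := hnorm z
      have hR0 : 0 ≤ R := norm_nonneg _
      nlinarith
    rw [← Set.compl_eq_univ_diff]
    simp only [Measure.real] at h1 h2
    linarith
  refine ⟨hmain, hpos, fun h => ?_⟩
  rw [h, inner_zero_right] at hmain
  linarith
end

section
/- (Gravity principle for the centre of mass, Lemma 3.5.) Let d ≥ 1 and let μ be a finite non-atomic Borel measure on ℝ^d with finite first moment whose support is not contained in a line. If μ(B(0,1)) > (3/4)·μ(ℝ^d), then every global minimizer x₀ of Φ_μ (i.e. the centre of mass of μ) satisfies ‖x₀‖ < 2; in particular the centre of mass lies in the ball B(0,2). -/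
open MeasureTheory

lemma le_of_sq_aux {a b : ℝ} (h : a ^ 2 ≤ b ^ 2) (hb : 0 ≤ b) : a ≤ b :=
  by nlinarith [abs_le_of_sq_le_sq h hb]

/-- Pointwise estimate: a unit step towards the origin brings the point closer to the ball. -/
lemma step_gain {E : Type*} [NormedAddCommGroup E] [InnerProductSpace ℝ E]
    (x u z : E) (R : ℝ) (hR : 2 ≤ R) (hu : ‖u‖ = 1) (hx : x = R • u) (hz : ‖z‖ < 1) :
    ‖(x - u) - z‖ ≤ ‖x - z‖ - 1 / 3 := by
  set w := inner ℝ u z with hw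
  have huu : inner ℝ u u = (1 : ℝ) := by rw [real_inner_self_eq_norm_sq, hu]; norm_num
  have hwb : |w| ≤ ‖u‖ * ‖z‖ := abs_real_inner_le_norm u z
  rw [hu, one_mul, abs_le] at hwb
  have key : ∀ c : ℝ, ‖c • u - z‖ ^ 2 = c ^ 2 - 2 * c * w + ‖z‖ ^ 2 := by
    intro c
    rw [norm_sub_sq_real, norm_smul, hu, real_inner_smul_left, mul_one, Real.norm_eq_abs, sq_abs]
    ring
  have h1 : ‖x - z‖ ^ 2 = R ^ 2 - 2 * R * w + ‖z‖ ^ 2 := by rw [hx]; exact key R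
  have h2 : ‖(x - u) - z‖ ^ 2 = (R - 1) ^ 2 - 2 * (R - 1) * w + ‖z‖ ^ 2 := by
    rw [← key (R - 1), hx, sub_smul, one_smul]
  have hz0 := norm_nonneg z
  set a := ‖x - z‖ with ha
  have ha0 : 0 ≤ a := norm_nonneg _
  have hwz : w ^ 2 ≤ ‖z‖ ^ 2 := sq_le_sq' hwb.1 hwb.2
  have hz1 : ‖z‖ ^ 2 ≤ 1 := pow_le_one₀ hz0 hz.le
  have hp : 1 < R - w := by linarith
  have hap : R - w ≤ a := by
    refine le_of_sq_aux ?_ ha0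
    rw [h1]
    linarith [sub_sq R w]
  have hau : a ≤ 3 * (R - w) - 4 / 3 := by
    refine le_of_sq_aux ?_ (by linarith)
    have h3 : 0 ≤ (R - w) * (R - w - 1) := mul_nonneg (by linarith) (by linarith)
    rw [h1]
    ring_nf at h3 ⊢
    linarith [sq_nonneg w]
  refine le_of_sq_aux ?_ (by linarith)
  have h4 : (a - 1 / 3) ^ 2 = a ^ 2 - 2 / 3 * a + 1 / 9 := by ring
  rw [h4, h2, h1]
  ring_nf
  linarith

/-- Gravity principle for the centre of mass (Lemma 3.5): if more than three quarters of
the mass of `μ` lies in `B(0,1)`, then every global minimizer of `Φ_μ` (the centre of mass)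
lies in `B(0,2)`. -/
theorem stmt_6 (d : ℕ) (hd : 1 ≤ d)
    (μ : Measure (EuclideanSpace ℝ (Fin d))) [IsFiniteMeasure μ]
    (hatom : ∀ x : EuclideanSpace ℝ (Fin d), μ {x} = 0)
    (hmom : Integrable (fun z : EuclideanSpace ℝ (Fin d) => ‖z‖) μ)
    (hline : ∀ a v : EuclideanSpace ℝ (Fin d),
      μ {x | ∃ t : ℝ, x = a + t • v} < μ Set.univ)
    (hball : (3 / 4 : ℝ) * (μ Set.univ).toReal <
      (μ (Metric.ball (0 : EuclideanSpace ℝ (Fin d)) 1)).toReal) :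
    ∀ x₀ : EuclideanSpace ℝ (Fin d),
      (∀ x : EuclideanSpace ℝ (Fin d), (∫ z, ‖x₀ - z‖ ∂μ) ≤ ∫ z, ‖x - z‖ ∂μ) →
        ‖x₀‖ < 2 ∧ x₀ ∈ Metric.ball (0 : EuclideanSpace ℝ (Fin d)) 2 := by
  intro x₀ hmin
  suffices h : ‖x₀‖ < 2 from ⟨h, by simpa using h⟩
  by_contra! hR
  have hpos : 0 < ‖x₀‖ := by linarith
  obtain ⟨u, hu⟩ : ∃ u, u = ‖x₀‖⁻¹ • x₀ := ⟨_, rfl⟩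
  have hu1 : ‖u‖ = 1 := by
    rw [hu, norm_smul, norm_inv, norm_norm, inv_mul_cancel₀ hpos.ne']
  have hx : x₀ = ‖x₀‖ • u := by rw [hu, smul_inv_smul₀ hpos.ne']
  have hint : ∀ x : EuclideanSpace ℝ (Fin d), Integrable (fun z => ‖x - z‖) μ := by
    intro x
    refine Integrable.mono' (g := fun z => ‖x‖ + ‖z‖) ((integrable_const _).add hmom)
      (by fun_prop) (Filter.Eventually.of_forall fun z => ?_)
    rw [norm_norm]
    exact norm_sub_le x z
  have hB : MeasurableSet (Metric.ball (0 : EuclideanSpace ℝ (Fin d)) 1) := measurableSet_ball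
  have hI : Integrable ((Metric.ball (0 : EuclideanSpace ℝ (Fin d)) 1).indicator
      (fun _ => (4 / 3 : ℝ))) μ := (integrable_const _).indicator hB
  have hle : ∫ z, ((Metric.ball (0 : EuclideanSpace ℝ (Fin d)) 1).indicator
      (fun _ => (4 / 3 : ℝ)) z - 1) ∂μ ≤ ∫ z, (‖x₀ - z‖ - ‖(x₀ - u) - z‖) ∂μ := by
    refine integral_mono (hI.sub (integrable_const _)) ((hint _).sub (hint _)) fun z => ?_
    by_cases hz : z ∈ Metric.ball (0 : EuclideanSpace ℝ (Fin d)) 1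
    · have := step_gain x₀ u z ‖x₀‖ hR hu1 hx (by simpa using hz)
      simp only [Set.indicator_of_mem hz]
      linarith
    · simp only [Set.indicator_of_notMem hz]
      have h := norm_sub_le (x₀ - z) u
      rw [hu1, sub_right_comm] at h
      linarith
  rw [integral_sub hI (integrable_const _), integral_sub (hint _) (hint _),
    integral_indicator_const _ hB, integral_const] at hle
  simp only [Measure.real, smul_eq_mul] at hle
  have := hmin (x₀ - u)
  linarith
end

section
/- (Measure-theoretic content of Proposition 3.4, renormalisation near a pole.) Let d ≥ 2, let V > 0 and let 0 < ε < ω < V/10 with ε < 1/8. Let μ be a finite Borel measure on ℝ^d which is absolutely continuous with respect to Lebesgue measure, satisfies μ(ℝ^d \ B(0,1)) = 0, has total mass μ(ℝ^d) ≥ V, and satisfies the concentration condition μ(B(0,ε)) ≥ μ(ℝ^d) − ε. Then there exist λ ≥ 1 and x₀ ∈ ℝ^d with ‖x₀‖ < 2ε such that, setting r = λ(1 − 2ε) (so that r ≥ 1/(3ε) − 2), T : ℝ^d → ℝ^d, T(x) = λ·(x − x₀) + x₀, and ν = T_*μ (the pushforward of μ under T), the following hold: (i) B(0,r) ⊆ T(B(0,1));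 (ii) ν(B(0,r) \ B(0,1)) ≤ 2ω; (iii) ν(B(z,1/4)) ≤ μ(ℝ^d) − ω for every z ∈ B(0,r); (iv) ν(B(0,r)) ≥ μ(ℝ^d) − ε. (All measure values are finite and are compared as real numbers.) -/
open MeasureTheory

theorem aux_small (d : ℕ) (hd : 2 ≤ d) (μ : Measure (EuclideanSpace ℝ (Fin d)))
    [IsFiniteMeasure μ] (hac : μ ≪ volume) (a : ℝ) (ha : 0 < a) :
    ∃ δ > 0, ∀ x : EuclideanSpace ℝ (Fin d), ‖x‖ ≤ 1 → μ.real (Metric.ball x δ) < a := by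
  haveI : Nonempty (Fin d) := ⟨⟨0, by omega⟩⟩
  haveI : Nontrivial (EuclideanSpace ℝ (Fin d)) := inferInstance
  have hK : IsCompact (Metric.closedBall (0 : EuclideanSpace ℝ (Fin d)) 1) :=
    isCompact_closedBall _ _
  obtain ⟨δ, hδ, h⟩ := lebesgue_number_lemma_of_metric_sUnion
    (c := {U : Set (EuclideanSpace ℝ (Fin d)) | IsOpen U ∧ μ U < ENNReal.ofReal a}) hK
    (fun U hU => hU.1) (by
      intro x _
      have h0 : μ {x} = 0 := hac (measure_singleton x)
      obtain ⟨U, hxU, hU, hlt⟩ := Set.exists_isOpen_lt_of_lt (μ := μ) {x} (ENNReal.ofReal a)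
        (by rw [h0]; simpa using ha)
      exact ⟨U, ⟨hU, hlt⟩, hxU rfl⟩)
  refine ⟨δ, hδ, fun x hx => ?_⟩
  obtain ⟨U, ⟨_, hU⟩, hsub⟩ := h x (by simpa using hx)
  have : μ (Metric.ball x δ) < ENNReal.ofReal a := lt_of_le_of_lt (measure_mono hsub) hU
  rw [Measure.real]
  exact (ENNReal.lt_ofReal_iff_toReal_lt (measure_ne_top _ _)).1 this

theorem aux_near {d : ℕ} (μ : Measure (EuclideanSpace ℝ (Fin d)))
    [IsFiniteMeasure μ] (ε s : ℝ) (x : EuclideanSpace ℝ (Fin d))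
    (h : μ.real Set.univ < μ.real (Metric.ball x s) + μ.real (Metric.ball 0 ε)) :
    ‖x‖ < s + ε := by
  by_contra hc
  have hdis : Disjoint (Metric.ball x s) (Metric.ball 0 ε) := by
    apply Metric.ball_disjoint_ball
    rw [dist_zero_right]; linarith
  have := measureReal_union (μ := μ) hdis measurableSet_ball
  have h2 := measureReal_mono (μ := μ) (Set.subset_univ (Metric.ball x s ∪ Metric.ball 0 ε))
  linarith

/-- Measure-theoretic content of Proposition 3.4 (renormalisation near a pole): for a
finite absolutely continuous measure `μ` supported in `B(0,1)` with total mass at least `V`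
and mass concentrated in `B(0,ε)`, there are `λ ≥ 1` and `x₀` with `‖x₀‖ < 2ε` such that
the pushforward `ν = T_*μ` under `T(x) = λ(x − x₀) + x₀` satisfies, with `r = λ(1 − 2ε)`:
`B(0,r) ⊆ T(B(0,1))`, `ν(B(0,r) \ B(0,1)) ≤ 2ω`, `ν(B(z,1/4)) ≤ μ(ℝ^d) − ω` for all
`z ∈ B(0,r)`, and `ν(B(0,r)) ≥ μ(ℝ^d) − ε`. -/
theorem stmt_7 (d : ℕ) (hd : 2 ≤ d) (V : ℝ) (hV : 0 < V) (ε ω : ℝ)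
    (hε : 0 < ε) (hεω : ε < ω) (hω : ω < V / 10) (hε8 : ε < 1 / 8)
    (μ : Measure (EuclideanSpace ℝ (Fin d))) [IsFiniteMeasure μ]
    (hac : μ ≪ volume)
    (hsupp : μ (Set.univ \ Metric.ball (0 : EuclideanSpace ℝ (Fin d)) 1) = 0)
    (hmass : V ≤ (μ Set.univ).toReal)
    (hconc : (μ Set.univ).toReal - ε ≤
      (μ (Metric.ball (0 : EuclideanSpace ℝ (Fin d)) ε)).toReal) :
    ∃ (l : ℝ) (x₀ : EuclideanSpace ℝ (Fin d)), 1 ≤ l ∧ ‖x₀‖ < 2 * ε ∧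
      1 / (3 * ε) - 2 ≤ l * (1 - 2 * ε) ∧
      Metric.ball (0 : EuclideanSpace ℝ (Fin d)) (l * (1 - 2 * ε)) ⊆
        (fun x => l • (x - x₀) + x₀) '' Metric.ball 0 1 ∧
      ((Measure.map (fun x => l • (x - x₀) + x₀) μ)
        (Metric.ball (0 : EuclideanSpace ℝ (Fin d)) (l * (1 - 2 * ε)) \
          Metric.ball 0 1)).toReal ≤ 2 * ω ∧
      (∀ z ∈ Metric.ball (0 : EuclideanSpace ℝ (Fin d)) (l * (1 - 2 * ε)),
        ((Measure.map (fun x => l • (x - x₀) + x₀) μ)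
          (Metric.ball z (1 / 4))).toReal ≤ (μ Set.univ).toReal - ω) ∧
      (μ Set.univ).toReal - ε ≤
        ((Measure.map (fun x => l • (x - x₀) + x₀) μ)
          (Metric.ball (0 : EuclideanSpace ℝ (Fin d)) (l * (1 - 2 * ε)))).toReal := by
  change V ≤ μ.real Set.univ at hmass
  change μ.real Set.univ - ε ≤ μ.real _ at hconc
  change ∃ (l : ℝ) (x₀ : EuclideanSpace ℝ (Fin d)), 1 ≤ l ∧ ‖x₀‖ < 2 * ε ∧
      1 / (3 * ε) - 2 ≤ l * (1 - 2 * ε) ∧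
      Metric.ball (0 : EuclideanSpace ℝ (Fin d)) (l * (1 - 2 * ε)) ⊆
        (fun x => l • (x - x₀) + x₀) '' Metric.ball 0 1 ∧
      (Measure.map (fun x => l • (x - x₀) + x₀) μ).real
        (Metric.ball (0 : EuclideanSpace ℝ (Fin d)) (l * (1 - 2 * ε)) \
          Metric.ball 0 1) ≤ 2 * ω ∧
      (∀ z ∈ Metric.ball (0 : EuclideanSpace ℝ (Fin d)) (l * (1 - 2 * ε)),
        (Measure.map (fun x => l • (x - x₀) + x₀) μ).real
          (Metric.ball z (1 / 4)) ≤ μ.real Set.univ - ω) ∧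
      μ.real Set.univ - ε ≤
        (Measure.map (fun x => l • (x - x₀) + x₀) μ).real
          (Metric.ball (0 : EuclideanSpace ℝ (Fin d)) (l * (1 - 2 * ε)))
  set M := μ.real Set.univ with hM
  -- choice of the scale
  have key : ∃ (s : ℝ) (x₀ : EuclideanSpace ℝ (Fin d)), 0 < s ∧ s ≤ ε ∧
      M - ω ≤ μ.real (Metric.ball x₀ s) ∧
      ∀ y, μ.real (Metric.ball y (s / 2)) < M - ω := by
    obtain ⟨δ, hδ, hsm⟩ := aux_small d hd μ hac (M - ω) (by linarith)
    have hex : ∃ n : ℕ, ∀ y, μ.real (Metric.ball y (ε * (1 / 2) ^ n)) < M - ω := by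
      obtain ⟨n, hn⟩ := exists_pow_lt_of_lt_one hδ (show (1 / 2 : ℝ) < 1 by norm_num)
      refine ⟨n, fun y => ?_⟩
      have hp : (0 : ℝ) < (1 / 2) ^ n := by positivity
      have hp1 : (1 / 2 : ℝ) ^ n ≤ 1 := pow_le_one₀ (by norm_num) (by norm_num)
      by_contra hc
      push Not at hc
      have hy := aux_near μ ε (ε * (1 / 2) ^ n) y (by linarith)
      have h1 := hsm y (by nlinarith)
      have h2 := measureReal_mono (μ := μ)
        (Metric.ball_subset_ball (x := y) (show ε * (1 / 2) ^ n ≤ δ by nlinarith))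
      linarith
    classical
    have hmin := fun m => Nat.find_min hex (m := m)
    have hspec := Nat.find_spec hex
    rcases hn : Nat.find hex with _ | n
    · rw [hn] at hspec
      have := hspec 0
      simp only [pow_zero, mul_one] at this
      linarith
    · rw [hn] at hspec
      have h1 := hmin n (by omega)
      push Not at h1
      obtain ⟨x, hx⟩ := h1
      refine ⟨ε * (1 / 2) ^ n, x, by positivity, ?_, hx, fun y => ?_⟩
      · have hp1 : (1 / 2 : ℝ) ^ n ≤ 1 := pow_le_one₀ (by norm_num) (by norm_num)
        nlinarith
      · have := hspec y
        rw [show ε * (1 / 2) ^ n / 2 = ε * (1 / 2) ^ (n + 1) by ring]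
        exact this
  obtain ⟨s, x₀, hs, hsε, hbig, hsmall⟩ := key
  have hx₀ : ‖x₀‖ < 2 * ε := by
    have := aux_near μ ε s x₀ (by linarith)
    linarith
  obtain ⟨l, hl⟩ : ∃ l : ℝ, l = 1 / (2 * s) := ⟨_, rfl⟩
  have hls : l * s = 1 / 2 := by rw [hl]; field_simp
  have hl0 : 0 < l := by rw [hl]; positivity
  have hlε : 1 / 2 ≤ l * ε := by nlinarith
  have hl1 : 1 ≤ l := by nlinarith
  have hmeas : Measurable (fun x : EuclideanSpace ℝ (Fin d) => l • (x - x₀) + x₀) := by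
    fun_prop
  have hmap : ∀ A : Set (EuclideanSpace ℝ (Fin d)), MeasurableSet A →
      (Measure.map (fun x => l • (x - x₀) + x₀) μ).real A =
        μ.real ((fun x => l • (x - x₀) + x₀) ⁻¹' A) := fun A hA =>
    map_measureReal_apply hmeas hA
  refine ⟨l, x₀, hl1, hx₀, ?_, ?_, ?_, ?_, ?_⟩
  · have h1 : 1 / (2 * ε) ≤ l := by
      rw [div_le_iff₀ (by positivity)]; linarith
    have h2 : 1 / (2 * ε) * (1 - 2 * ε) ≤ l * (1 - 2 * ε) :=
      mul_le_mul_of_nonneg_right h1 (by linarith)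
    have h3 : 1 / (2 * ε) * (1 - 2 * ε) = 1 / (2 * ε) - 1 := by field_simp
    have h4 : 1 / (3 * ε) ≤ 1 / (2 * ε) := by
      apply one_div_le_one_div_of_le <;> linarith
    linarith
  · intro y hy
    rw [mem_ball_zero_iff] at hy
    refine ⟨l⁻¹ • y + (1 - l⁻¹) • x₀, ?_, ?_⟩
    · rw [mem_ball_zero_iff]
      have hi : l⁻¹ ≤ 1 := inv_le_one_of_one_le₀ hl1
      have hi0 : 0 < l⁻¹ := inv_pos.2 hl0
      have h1 := norm_add_le (l⁻¹ • y) ((1 - l⁻¹) • x₀)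
      rw [norm_smul, norm_smul, Real.norm_of_nonneg hi0.le,
        Real.norm_of_nonneg (by linarith : 0 ≤ 1 - l⁻¹)] at h1
      have h2 : l⁻¹ * ‖y‖ < 1 - 2 * ε := by
        rw [inv_mul_lt_iff₀ hl0]; exact hy
      have h3 := norm_nonneg x₀
      nlinarith
    · have : l⁻¹ • y + (1 - l⁻¹) • x₀ - x₀ = l⁻¹ • (y - x₀) := by module
      simp only [this]
      rw [smul_inv_smul₀ hl0.ne']; simp
  · rw [hmap _ (measurableSet_ball.diff measurableSet_ball)]
    have hsub : (fun x => l • (x - x₀) + x₀) ⁻¹'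
        (Metric.ball (0 : EuclideanSpace ℝ (Fin d)) (l * (1 - 2 * ε)) \ Metric.ball 0 1) ⊆
        (Metric.ball x₀ s)ᶜ := by
      rintro x ⟨_, hx⟩ hxs
      apply hx
      rw [mem_ball_zero_iff]
      rw [mem_ball_iff_norm] at hxs
      have h1 := norm_add_le (l • (x - x₀)) x₀
      rw [norm_smul, Real.norm_of_nonneg hl0.le] at h1
      nlinarith
    have h1 := measureReal_mono (μ := μ) hsub
    have h2 := measureReal_compl (μ := μ) (s := Metric.ball x₀ s) measurableSet_ball
    linarith
  · intro z _
    rw [hmap _ measurableSet_ball]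
    have hsub : (fun x => l • (x - x₀) + x₀) ⁻¹' (Metric.ball z (1 / 4)) ⊆
        Metric.ball (l⁻¹ • z + (1 - l⁻¹) • x₀) (s / 2) := by
      intro x hx
      rw [Set.mem_preimage, mem_ball_iff_norm] at hx
      rw [mem_ball_iff_norm]
      have h1 : l • (x - x₀) + x₀ - z = l • (x - (l⁻¹ • z + (1 - l⁻¹) • x₀)) := by
        have : l * l⁻¹ = 1 := mul_inv_cancel₀ hl0.ne'
        rw [smul_sub, smul_sub, smul_add, smul_smul, smul_smul, mul_sub, this]
        module
      rw [h1, norm_smul, Real.norm_of_nonneg hl0.le] at hx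
      nlinarith
    have h1 := measureReal_mono (μ := μ) hsub
    have h2 := hsmall (l⁻¹ • z + (1 - l⁻¹) • x₀)
    linarith
  · rw [hmap _ measurableSet_ball]
    refine hconc.trans (measureReal_mono ?_)
    intro x hx
    rw [mem_ball_zero_iff] at hx
    rw [Set.mem_preimage, mem_ball_zero_iff]
    have h0 : l • (x - x₀) + x₀ = l • x - (l - 1) • x₀ := by module
    have h1 := norm_sub_le (l • x) ((l - 1) • x₀)
    rw [norm_smul, norm_smul, Real.norm_of_nonneg hl0.le,
      Real.norm_of_nonneg (by linarith : 0 ≤ l - 1)] at h1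
    rw [h0]
    have h3 := norm_nonneg x₀
    nlinarith
end

section
/- (Intermediate value step in the proof of Proposition 3.4.) Let d ≥ 1, let μ be a finite Borel measure on ℝ^d which is absolutely continuous with respect to Lebesgue measure and satisfies μ(ℝ^d \ B(0,1)) = 0, let x₀ ∈ B(0,1), and let ω > 0 satisfy 2ω < μ(ℝ^d). For λ ≥ 1 set T_λ(x) = λ·(x − x₀) + x₀ and Ψ(λ) = ((T_λ)_*μ)(T_λ(B(0,1)) \ B(0,1)). Then: (a) there exists λ ≥ 1 with Ψ(λ) = 2ω; and (b) if moreover 0 < ε < ω, ‖x₀‖ ≤ 2ε, and μ(B(0,ε)) ≥ μ(ℝ^d) − ε, then every λ ≥ 1 with Ψ(λ) = 2ω satisfies λ ≥ (1 − 2ε)/(3ε). -/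
open MeasureTheory

/-- The measure of the exit set is the measure of `{x | 1 ≤ ‖T x‖}`. -/
lemma psi_eq (d : ℕ)
    (μ : Measure (EuclideanSpace ℝ (Fin d)))
    (hsupp : μ (Set.univ \ Metric.ball (0 : EuclideanSpace ℝ (Fin d)) 1) = 0)
    (x₀ : EuclideanSpace ℝ (Fin d)) (l : ℝ) (hl : 1 ≤ l) :
    (Measure.map (fun x => l • (x - x₀) + x₀) μ)
        ((fun x => l • (x - x₀) + x₀) '' Metric.ball 0 1 \ Metric.ball 0 1)
      = μ {x | 1 ≤ ‖l • (x - x₀) + x₀‖} := by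
  have hl0 : l ≠ 0 := by positivity
  have hemb : MeasurableEmbedding (fun x : EuclideanSpace ℝ (Fin d) => l • (x - x₀) + x₀) :=
    (((Homeomorph.subRight x₀).trans (Homeomorph.smulOfNeZero l hl0)).trans
      (Homeomorph.addRight x₀)).measurableEmbedding
  rw [hemb.map_apply, Set.preimage_sdiff, Set.preimage_image_eq _ hemb.injective]
  have hset : (fun x => l • (x - x₀) + x₀) ⁻¹' Metric.ball 0 1
      = {x | 1 ≤ ‖l • (x - x₀) + x₀‖}ᶜ := by
    ext x
    simp
  rw [hset, Set.sdiff_eq, compl_compl]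
  have hae : ∀ᵐ x ∂μ, x ∈ Metric.ball (0 : EuclideanSpace ℝ (Fin d)) 1 := by
    rw [← Set.compl_eq_univ_sdiff] at hsupp
    exact mem_ae_iff.mpr hsupp
  exact Measure.measure_inter_eq_of_ae hae

lemma meas_set (d : ℕ) (x₀ : EuclideanSpace ℝ (Fin d)) (l : ℝ) :
    MeasurableSet {x : EuclideanSpace ℝ (Fin d) | 1 ≤ ‖l • (x - x₀) + x₀‖} :=
  (isClosed_le (by fun_prop) (by fun_prop)).measurableSet

lemma psi_cont (d : ℕ) (μ : Measure (EuclideanSpace ℝ (Fin d))) [IsFiniteMeasure μ]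
    (hac : μ ≪ volume) (x₀ : EuclideanSpace ℝ (Fin d)) (l : ℝ) (hl : 1 ≤ l) :
    ContinuousAt (fun l : ℝ => (μ {x | 1 ≤ ‖l • (x - x₀) + x₀‖}).toReal) l := by
  have hl0 : 0 < l := by positivity
  refine (ENNReal.tendsto_toReal (measure_ne_top _ _)).comp ?_
  refine tendsto_measure_of_ae_tendsto_indicator_of_isFiniteMeasure _ (meas_set d x₀ l)
    (fun i => meas_set d x₀ i) ?_
  have hnull : (volume : Measure (EuclideanSpace ℝ (Fin d)))
      (Metric.sphere (x₀ - l⁻¹ • x₀) l⁻¹) = 0 :=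
    Measure.addHaar_sphere_of_ne_zero _ _ (by positivity)
  have hae : ∀ᵐ x ∂μ, ‖l • (x - x₀) + x₀‖ ≠ 1 := by
    rw [ae_iff]
    refine measure_mono_null ?_ (hac hnull)
    intro x hx
    simp only [ne_eq, not_not, Set.mem_ofPred_eq] at hx
    have h1 : l • (x - x₀) + x₀ = l • (x - (x₀ - l⁻¹ • x₀)) := by
      have : l • l⁻¹ • x₀ = x₀ := smul_inv_smul₀ hl0.ne' _
      simp only [smul_sub, this]
      abel
    rw [h1, norm_smul, Real.norm_of_nonneg hl0.le] at hx
    rw [mem_sphere_iff_norm]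
    exact eq_inv_of_mul_eq_one_right hx
  filter_upwards [hae] with x hx
  have hc : ContinuousAt (fun i : ℝ => ‖i • (x - x₀) + x₀‖) l := by fun_prop
  rcases lt_or_gt_of_ne hx with h | h
  · filter_upwards [hc.eventually_lt_const h] with i hi
    constructor <;> intro hh <;> [have hh2 : 1 ≤ ‖i • (x - x₀) + x₀‖ := hh; have hh2 : 1 ≤ ‖l • (x - x₀) + x₀‖ := hh]
    · change 1 ≤ ‖l • (x - x₀) + x₀‖
      linarith
    · change 1 ≤ ‖i • (x - x₀) + x₀‖
      linarith
  · filter_upwards [hc.eventually_const_lt h] with i hi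
    constructor <;> intro hh <;> [have hh2 : 1 ≤ ‖i • (x - x₀) + x₀‖ := hh; have hh2 : 1 ≤ ‖l • (x - x₀) + x₀‖ := hh]
    · change 1 ≤ ‖l • (x - x₀) + x₀‖
      linarith
    · change 1 ≤ ‖i • (x - x₀) + x₀‖
      linarith

lemma psi_lim (d : ℕ) (hd : 1 ≤ d) (μ : Measure (EuclideanSpace ℝ (Fin d))) [IsFiniteMeasure μ]
    (hac : μ ≪ volume) (x₀ : EuclideanSpace ℝ (Fin d)) :
    Filter.Tendsto (fun l : ℝ => (μ {x | 1 ≤ ‖l • (x - x₀) + x₀‖}).toReal) Filter.atTop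
      (nhds (μ Set.univ).toReal) := by
  refine (ENNReal.tendsto_toReal (measure_ne_top _ _)).comp ?_
  refine tendsto_measure_of_ae_tendsto_indicator_of_isFiniteMeasure _ MeasurableSet.univ
    (fun i => meas_set d x₀ i) ?_
  have : Nonempty (Fin d) := ⟨⟨0, hd⟩⟩
  have hnull : (volume : Measure (EuclideanSpace ℝ (Fin d))) {x₀} = 0 := measure_singleton _
  have hae : ∀ᵐ x ∂μ, x ≠ x₀ := by
    rw [ae_iff]
    refine measure_mono_null ?_ (hac hnull)
    intro x hx
    simpa using hx
  filter_upwards [hae] with x hx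
  have hpos : 0 < ‖x - x₀‖ := norm_pos_iff.mpr (sub_ne_zero.mpr hx)
  filter_upwards [Filter.eventually_ge_atTop ((1 + ‖x₀‖) / ‖x - x₀‖),
    Filter.eventually_ge_atTop 0] with l h1 h0
  simp only [Set.mem_univ, iff_true]
  rw [div_le_iff₀ hpos] at h1
  have h2 := norm_sub_le (l • (x - x₀) + x₀) x₀
  rw [add_sub_cancel_right, norm_smul, Real.norm_of_nonneg h0] at h2
  linarith

/-- Intermediate value step in the proof of Proposition 3.4: with
`Ψ(λ) = ((T_λ)_*μ)(T_λ(B(0,1)) \ B(0,1))` where `T_λ(x) = λ(x − x₀) + x₀`,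
(a) there is `λ ≥ 1` with `Ψ(λ) = 2ω`; and (b) if `0 < ε < ω`, `‖x₀‖ ≤ 2ε`, and
`μ(B(0,ε)) ≥ μ(ℝ^d) − ε`, then every `λ ≥ 1` with `Ψ(λ) = 2ω` satisfies
`λ ≥ (1 − 2ε)/(3ε)`. -/
theorem stmt_8 (d : ℕ) (hd : 1 ≤ d)
    (μ : Measure (EuclideanSpace ℝ (Fin d))) [IsFiniteMeasure μ]
    (hac : μ ≪ volume)
    (hsupp : μ (Set.univ \ Metric.ball (0 : EuclideanSpace ℝ (Fin d)) 1) = 0)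
    (x₀ : EuclideanSpace ℝ (Fin d))
    (hx₀ : x₀ ∈ Metric.ball (0 : EuclideanSpace ℝ (Fin d)) 1)
    (ω : ℝ) (hω : 0 < ω) (h2ω : 2 * ω < (μ Set.univ).toReal) :
    (∃ l : ℝ, 1 ≤ l ∧
      ((Measure.map (fun x => l • (x - x₀) + x₀) μ)
        ((fun x => l • (x - x₀) + x₀) '' Metric.ball 0 1 \
          Metric.ball 0 1)).toReal = 2 * ω) ∧
    (∀ ε : ℝ, 0 < ε → ε < ω → ‖x₀‖ ≤ 2 * ε →
      (μ Set.univ).toReal - ε ≤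
        (μ (Metric.ball (0 : EuclideanSpace ℝ (Fin d)) ε)).toReal →
      ∀ l : ℝ, 1 ≤ l →
        ((Measure.map (fun x => l • (x - x₀) + x₀) μ)
          ((fun x => l • (x - x₀) + x₀) '' Metric.ball 0 1 \
            Metric.ball 0 1)).toReal = 2 * ω →
        (1 - 2 * ε) / (3 * ε) ≤ l) := by
  constructor
  · have h1 := (psi_lim d hd μ hac x₀).eventually_const_lt h2ω
    obtain ⟨L, hL, hL1⟩ := (h1.and (Filter.eventually_ge_atTop 1)).exists
    have hz : (μ {x | 1 ≤ ‖(1 : ℝ) • (x - x₀) + x₀‖}).toReal = 0 := by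
      have : {x : EuclideanSpace ℝ (Fin d) | 1 ≤ ‖(1 : ℝ) • (x - x₀) + x₀‖}
          = Set.univ \ Metric.ball 0 1 := by
        ext x
        simp
      rw [this, hsupp, ENNReal.toReal_zero]
    have hivt := intermediate_value_Icc (f := fun l : ℝ =>
      (μ {x | 1 ≤ ‖l • (x - x₀) + x₀‖}).toReal) hL1
      (fun l hl => (psi_cont d μ hac x₀ l hl.1).continuousWithinAt)
    obtain ⟨l, hl, hl2⟩ := hivt (show 2 * ω ∈ Set.Icc _ _ from
      ⟨by simp only [hz]; positivity, hL.le⟩)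
    refine ⟨l, hl.1, ?_⟩
    rw [psi_eq d μ hsupp x₀ l hl.1]
    exact hl2
  · intro ε hε hεω hx hμ l hl heq
    rw [psi_eq d μ hsupp x₀ l hl] at heq
    by_contra hcon
    rw [not_le, lt_div_iff₀ (by positivity)] at hcon
    have hsub : {x | 1 ≤ ‖l • (x - x₀) + x₀‖} ⊆ (Metric.ball 0 ε)ᶜ := by
      intro x hx1 hxb
      rw [mem_ball_zero_iff] at hxb
      have hx2 : 1 ≤ ‖l • (x - x₀) + x₀‖ := hx1
      have h1 := norm_add_le (l • (x - x₀)) x₀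
      rw [norm_smul, Real.norm_of_nonneg (by linarith)] at h1
      have h2 := norm_sub_le x x₀
      have h3 : l * ‖x - x₀‖ ≤ l * (3 * ε) :=
        mul_le_mul_of_nonneg_left (by linarith) (by linarith)
      linarith
    have h1 : μ.real {x | 1 ≤ ‖l • (x - x₀) + x₀‖} ≤ μ.real (Metric.ball 0 ε)ᶜ :=
      measureReal_mono hsub
    rw [measureReal_compl Metric.isOpen_ball.measurableSet] at h1
    simp only [measureReal_def] at h1
    linarith
end
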